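/- Almost surely, the set of points of local extremum of ω is countable; that is, the set of ω ∈ Ω for which the set of points of local extremum is uncountable is null. -/

import Mathlib

open Filter Topology MeasureTheory
open scoped ENNReal NNReal

namespace GTP

/-- The sample space `Ω`: all continuous functions `ω : [0,∞) → ℝ`. -/
def Omega : Type := {f : ℝ≥0 → ℝ // Continuous f}

/-- The filtration: `F t` is the smallest σ-algebra on `Ω` making all maps
`ω ↦ ω s`, `s ∈ [0,t]`, measurable. -/
def F (t : ℝ≥0) : MeasurableSpace Omega :=
  ⨆ s : {s : ℝ≥0 // s ≤ t},
    MeasurableSpace.comap (fun ω : Omega => ω.1 s.1) inferInstance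

/-- A stopping time relative to the filtration `(F t)`, with values in `[0,∞]`. -/
def IsStopping (τ : Omega → ℝ≥0∞) : Prop :=
  ∀ t : ℝ≥0, MeasurableSet[F t] {ω : Omega | τ ω ≤ (t : ℝ≥0∞)}

/-- `F_τ`-measurability of a function `h : Ω → ℝ`. -/
def MeasurableAtTime (τ : Omega → ℝ≥0∞) (h : Omega → ℝ) : Prop :=
  ∀ B : Set ℝ, MeasurableSet B → ∀ t : ℝ≥0,
    MeasurableSet[F t] (h ⁻¹' B ∩ {ω : Omega | τ ω ≤ (t : ℝ≥0∞)})

/-- An elementary trading strategy: an increasing sequence of stopping times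
`τ₁ ≤ τ₂ ≤ ⋯` tending to `∞`, together with bounded `F_{τ_n}`-measurable
portfolio functions `h_n`. -/
structure ElemStrategy where
  τ : ℕ → Omega → ℝ≥0∞
  stopping : ∀ n, IsStopping (τ n)
  mono : ∀ n ω, τ n ω ≤ τ (n + 1) ω
  tendsto_top : ∀ ω, Tendsto (fun n => τ n ω) atTop (𝓝 ⊤)
  h : ℕ → Omega → ℝ
  h_bdd : ∀ n, ∃ C : ℝ, ∀ ω, |h n ω| ≤ C
  h_meas : ∀ n, MeasurableAtTime (τ n) (h n)

/-- The time `τ ∧ t` as an element of `[0,∞)`. -/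
noncomputable def clip (τ : Omega → ℝ≥0∞) (t : ℝ≥0) (ω : Omega) : ℝ≥0 :=
  (min (τ ω) (t : ℝ≥0∞)).toNNReal

/-- The elementary capital process
`K_t(ω) := c + Σ_n h_n(ω) (ω(τ_{n+1} ∧ t) − ω(τ_n ∧ t))`. -/
noncomputable def elemCapital (G : ElemStrategy) (c : ℝ) (t : ℝ≥0) (ω : Omega) : ℝ :=
  c + ∑' n : ℕ, G.h n ω * (ω.1 (clip (G.τ (n + 1)) t ω) - ω.1 (clip (G.τ n) t ω))

/-- A positive capital process: a countable sum of nonnegative elementary capital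
processes with strictly positive summable initial capitals. -/
structure PosCapital where
  G : ℕ → ElemStrategy
  c : ℕ → ℝ
  c_pos : ∀ n, 0 < c n
  c_summable : Summable c
  nonneg : ∀ n t ω, 0 ≤ elemCapital (G n) (c n) t ω

/-- The value `S_t(ω) ∈ [0,∞]` of a positive capital process. -/
noncomputable def PosCapital.value (S : PosCapital) (t : ℝ≥0) (ω : Omega) : ℝ≥0∞ :=
  ∑' n : ℕ, ENNReal.ofReal (elemCapital (S.G n) (S.c n) t ω)

/-- The initial value `S_0` of a positive capital process (independent of `ω`,
since `K^{G_n,c_n}_0 = c_n`). -/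
noncomputable def PosCapital.init (S : PosCapital) : ℝ≥0∞ :=
  ∑' n : ℕ, ENNReal.ofReal (S.c n)

/-- Upper probability:
`UpProb(E) := inf { S₀ : S a positive capital process, liminf_{t→∞} S_t ≥ 1_E }`. -/
noncomputable def UpProb (E : Set Omega) : ℝ≥0∞ :=
  ⨅ (S : PosCapital) (_ : ∀ ω : Omega,
      E.indicator (fun _ => (1 : ℝ≥0∞)) ω ≤ liminf (fun t : ℝ≥0 => S.value t ω) atTop),
    S.init

/-- A set is null if its upper probability is `0`. -/
def IsNull (E : Set Omega) : Prop := UpProb E = 0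

/-- `[t₁,t₂]` is an interval of local extremum for `ω`, where the comparison
relation `r` is `≤` for a local maximum, `≥` for a local minimum, `<` for a
strict local maximum and `>` for a strict local minimum: (a) `ω` is constant on
`[t₁,t₂]` but on no larger interval, and (b) for some `δ > 0`,
`r (ω s) (ω t)` for all `s ∈ ((t₁−δ)⁺,t₁) ∪ (t₂,t₂+δ)` and `t ∈ [t₁,t₂]`. -/
def IntervalOfLocalExt (r : ℝ → ℝ → Prop) (ω : Omega) (t₁ t₂ : ℝ≥0) : Prop :=
  t₁ ≤ t₂ ∧
  (∀ t ∈ Set.Icc t₁ t₂, ω.1 t = ω.1 t₁) ∧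
  (¬ ∃ s₁ s₂ : ℝ≥0, s₁ ≤ t₁ ∧ t₂ ≤ s₂ ∧ (s₁ < t₁ ∨ t₂ < s₂) ∧
      ∀ t ∈ Set.Icc s₁ s₂, ω.1 t = ω.1 t₁) ∧
  ∃ δ : ℝ, 0 < δ ∧ ∀ s : ℝ≥0,
    (((t₁ : ℝ) - δ < (s : ℝ) ∧ s < t₁) ∨ (t₂ < s ∧ (s : ℝ) < (t₂ : ℝ) + δ)) →
      r (ω.1 s) (ω.1 t₁)

/-- `[t,∞)` is a ray of local extremum for `ω` (with `r` as above): (a) `ω` is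
constant on `[t,∞)` but on no larger ray `[s,∞)`, `s ∈ (0,t)`, and (b) for some
`δ > 0`, `r (ω s) (ω t)` for all `s ∈ ((t−δ)⁺, t)`. -/
def RayOfLocalExt (r : ℝ → ℝ → Prop) (ω : Omega) (t : ℝ≥0) : Prop :=
  (∀ u : ℝ≥0, t ≤ u → ω.1 u = ω.1 t) ∧
  (¬ ∃ s : ℝ≥0, 0 < s ∧ s < t ∧ ∀ u : ℝ≥0, s ≤ u → ω.1 u = ω.1 t) ∧
  ∃ δ : ℝ, 0 < δ ∧ ∀ s : ℝ≥0, (t : ℝ) - δ < (s : ℝ) → s < t → r (ω.1 s) (ω.1 t)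

lemma meas_eval {t v : ℝ≥0} (hv : v ≤ t) : @Measurable _ _ (F t) _ (fun ω : Omega => ω.1 v) := by
  apply Measurable.of_comap_le
  exact le_iSup (fun s : {s : ℝ≥0 // s ≤ t} =>
    MeasurableSpace.comap (fun ω : Omega => ω.1 s.1) inferInstance) ⟨v, hv⟩

/-- times after `q` at which `κ ω` is at least `c` above its values on `[a,q]` -/
def hitSet (κ : ℝ) (a q : ℝ≥0) (c : ℝ) (ω : Omega) : Set ℝ≥0 :=
  {u | q ≤ u ∧ ∀ v ∈ Set.Icc a q, κ * ω.1 v + c ≤ κ * ω.1 u}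

open Classical in
/-- the hitting time of `hitSet` -/
noncomputable def hit (κ : ℝ) (a q : ℝ≥0) (c : ℝ) (ω : Omega) : ℝ≥0∞ :=
  if (hitSet κ a q c ω).Nonempty then ((sInf (hitSet κ a q c ω) : ℝ≥0) : ℝ≥0∞) else ⊤

lemma hitSet_closed (κ : ℝ) (a q : ℝ≥0) (c : ℝ) (ω : Omega) : IsClosed (hitSet κ a q c ω) := by
  have hc := ω.2
  have : hitSet κ a q c ω = {u | q ≤ u} ∩ ⋂ v ∈ Set.Icc a q, {u | κ * ω.1 v + c ≤ κ * ω.1 u} := by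
    ext u; simp [hitSet]
  rw [this]
  refine (isClosed_le continuous_const continuous_id).inter ?_
  refine isClosed_biInter fun v _ => isClosed_le continuous_const (by fun_prop)

lemma hit_cases (κ : ℝ) (a q : ℝ≥0) (c : ℝ) (ω : Omega) :
    (hit κ a q c ω = ⊤ ∧ ∀ u, u ∉ hitSet κ a q c ω) ∨
    ∃ u ∈ hitSet κ a q c ω, hit κ a q c ω = (u : ℝ≥0∞) ∧ ∀ w ∈ hitSet κ a q c ω, u ≤ w := by
  by_cases h : (hitSet κ a q c ω).Nonempty
  · right
    refine ⟨sInf (hitSet κ a q c ω), (hitSet_closed κ a q c ω).csInf_mem h (OrderBot.bddBelow _),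
      by simp [hit, h], fun w hw => csInf_le (OrderBot.bddBelow _) hw⟩
  · left
    refine ⟨by simp [hit, h], fun u hu => h ⟨u, hu⟩⟩

lemma hit_le_iff (κ : ℝ) (a q : ℝ≥0) (c : ℝ) (ω : Omega) (t : ℝ≥0) :
    hit κ a q c ω ≤ (t : ℝ≥0∞) ↔ ∃ u ∈ hitSet κ a q c ω, u ≤ t := by
  rcases hit_cases κ a q c ω with ⟨h, h2⟩ | ⟨u, hu, h, h2⟩
  · rw [h]; simp; intro u hu; exact absurd hu (h2 u)
  · rw [h]
    constructor
    · intro hh; exact ⟨u, hu, by exact_mod_cast hh⟩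
    · rintro ⟨w, hw, hwt⟩
      exact_mod_cast (h2 w hw).trans hwt

lemma hit_stopping (κ : ℝ) (a q : ℝ≥0) (c : ℝ) : IsStopping (hit κ a q c) := by
  intro t
  letI := F t
  by_cases hqt : q ≤ t
  swap
  · convert MeasurableSet.empty
    ext ω
    simp only [Set.mem_ofPred_eq, hit_le_iff, Set.mem_empty_iff_false, iff_false]
    rintro ⟨u, hu, hut⟩
    exact hqt (hu.1.trans hut)
  obtain ⟨D, hDc, hD⟩ := TopologicalSpace.exists_countable_dense (Set.Icc q t)
  obtain ⟨D', hDc', hD'⟩ := TopologicalSpace.exists_countable_dense (Set.Icc a q)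
  have : {ω : Omega | hit κ a q c ω ≤ (t : ℝ≥0∞)} = ⋂ k : ℕ, ⋃ u ∈ D, ⋂ v ∈ D',
      {ω : Omega | κ * ω.1 v + c ≤ κ * ω.1 u + 1 / ((k : ℝ) + 1)} := by
    ext ω
    have hc := ω.2
    simp only [Set.mem_ofPred_eq, hit_le_iff, Set.mem_iInter, Set.mem_iUnion]
    constructor
    · rintro ⟨u, hu, hut⟩ k
      have hk : (0 : ℝ) < 1 / ((k : ℝ) + 1) := by positivity
      have ho : IsOpen {x : Set.Icc q t | κ * ω.1 u - 1 / ((k : ℝ) + 1) < κ * ω.1 x} :=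
        isOpen_lt continuous_const (by fun_prop)
      obtain ⟨x, hx, hxD⟩ := hD.exists_mem_open ho ⟨⟨u, hu.1, hut⟩, by simp only [Set.mem_ofPred_eq]; linarith⟩
      refine ⟨x, by assumption, fun v _ => ?_⟩
      have := hu.2 v v.2
      simp only [Set.mem_ofPred_eq] at *
      linarith
    · intro h
      obtain ⟨u, hu, hmax⟩ := isCompact_Icc.exists_isMaxOn (Set.nonempty_Icc.2 hqt)
        (f := fun x => κ * ω.1 x) (by fun_prop)
      refine ⟨u, ⟨hu.1, ?_⟩, hu.2⟩
      intro v hv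
      have hall : ∀ k : ℕ, κ * ω.1 v + c ≤ κ * ω.1 u + 1 / ((k : ℝ) + 1) := by
        intro k
        obtain ⟨x, hx, hxk⟩ := h k
        have hcl : IsClosed {v : Set.Icc a q | κ * ω.1 v + c ≤ κ * ω.1 x + 1 / ((k : ℝ) + 1)} :=
          isClosed_le (by fun_prop) continuous_const
        have hm := hcl.closure_subset_iff.2 (show D' ⊆ _ from fun v hv => hxk v hv) (hD' ⟨v, hv⟩)
        have := hmax x.2
        simp only [Set.mem_ofPred_eq] at *
        linarith
      have hl : Tendsto (fun k : ℕ => κ * ω.1 u + 1 / ((k : ℝ) + 1)) atTop (𝓝 (κ * ω.1 u + 0)) :=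
        tendsto_const_nhds.add tendsto_one_div_add_atTop_nhds_zero_nat
      simpa using ge_of_tendsto' hl hall
  rw [this]
  refine MeasurableSet.iInter fun k => MeasurableSet.biUnion hDc fun u _ =>
    MeasurableSet.biInter hDc' fun v _ => ?_
  exact measurableSet_le (((meas_eval (v.2.2.trans hqt)).const_mul κ).add_const c)
    (((meas_eval u.2.2).const_mul κ).add_const _)

lemma min_stopping {τ : Omega → ℝ≥0∞} (h : IsStopping τ) (s : ℝ≥0) :
    IsStopping (fun ω => min (τ ω) (s : ℝ≥0∞)) := by
  intro t
  letI := F t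
  have : {ω : Omega | min (τ ω) (s : ℝ≥0∞) ≤ (t : ℝ≥0∞)}
      = {ω | τ ω ≤ (t : ℝ≥0∞)} ∪ {_ω | (s : ℝ≥0∞) ≤ (t : ℝ≥0∞)} := by
    ext ω; simp
  rw [this]
  exact (h t).union (MeasurableSet.const _)

lemma const_meas {τ : Omega → ℝ≥0∞} (h : IsStopping τ) (x : ℝ) :
    MeasurableAtTime τ (fun _ => x) := by
  intro B _ t
  letI := F t
  exact (MeasurableSet.const (x ∈ B)).inter (h t)

lemma top_stopping : IsStopping (fun _ => ⊤) := by
  intro t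
  letI := F t
  exact MeasurableSet.const _

lemma hit_mono (κ : ℝ) (a q : ℝ≥0) (c : ℝ) (hc : 0 ≤ c) (ω : Omega) :
    hit κ a q 0 ω ≤ hit κ a q c ω := by
  rcases hit_cases κ a q c ω with ⟨h, h2⟩ | ⟨u, hu, h, h2⟩
  · rw [h]; exact le_top
  · rw [h, hit_le_iff]
    exact ⟨u, ⟨hu.1, fun v hv => by have := hu.2 v hv; linarith⟩, le_rfl⟩

/-- trading times -/
noncomputable def stratTime (κ : ℝ) (a q s : ℝ≥0) (c : ℝ) : ℕ → Omega → ℝ≥0∞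
  | 0 => fun ω => min (hit κ a q 0 ω) (s : ℝ≥0∞)
  | 1 => fun ω => min (hit κ a q c ω) (s : ℝ≥0∞)
  | _ + 2 => fun _ => ⊤

/-- positions -/
def stratPos (x : ℝ) : ℕ → Omega → ℝ
  | 0 => fun _ => x
  | _ + 1 => fun _ => 0

lemma stratTime_stopping (κ : ℝ) (a q s : ℝ≥0) (c : ℝ) :
    ∀ n, IsStopping (stratTime κ a q s c n)
  | 0 => min_stopping (hit_stopping _ _ _ _) s
  | 1 => min_stopping (hit_stopping _ _ _ _) s
  | _ + 2 => top_stopping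

/-- the strategy -/
noncomputable def strat (κ : ℝ) (a q s : ℝ≥0) (c : ℝ) (hc : 0 ≤ c) (x : ℝ) : ElemStrategy where
  τ := stratTime κ a q s c
  stopping := stratTime_stopping κ a q s c
  mono := by
    rintro (_ | _ | n) ω
    · exact min_le_min_right _ (hit_mono κ a q c hc ω)
    · exact le_top
    · exact le_top
  tendsto_top := by
    intro ω
    rw [← tendsto_add_atTop_iff_nat 2]
    exact tendsto_const_nhds
  h := stratPos x
  h_bdd := by
    rintro (_ | n)
    · exact ⟨|x|, fun _ => le_rfl⟩
    · exact ⟨0, fun _ => by simp [stratPos]⟩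
  h_meas := by
    rintro (_ | n)
    · exact const_meas (stratTime_stopping κ a q s c 0) x
    · exact const_meas (stratTime_stopping κ a q s c (n + 1)) 0

lemma strat_capital (κ : ℝ) (a q s : ℝ≥0) (c : ℝ) (hc : 0 ≤ c) (x e : ℝ) (t : ℝ≥0) (ω : Omega) :
    elemCapital (strat κ a q s c hc x) e t ω =
      e + x * (ω.1 (clip (hit κ a q c) (min s t) ω) - ω.1 (clip (hit κ a q 0) (min s t) ω)) := by
  unfold elemCapital
  rw [tsum_eq_single 0]
  · simp [strat, stratPos, stratTime, clip, min_assoc]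
  · rintro (_ | n) hn
    · exact absurd rfl hn
    · simp [strat, stratPos]

lemma clip_cases (κ : ℝ) (a q : ℝ≥0) (c : ℝ) (T : ℝ≥0) (ω : Omega) :
    (∃ u ∈ hitSet κ a q c ω, u ≤ T ∧ clip (hit κ a q c) T ω = u ∧
      ∀ w ∈ hitSet κ a q c ω, u ≤ w) ∨
    (clip (hit κ a q c) T ω = T ∧ ∀ u ∈ hitSet κ a q c ω, T < u) := by
  rcases hit_cases κ a q c ω with ⟨h, h2⟩ | ⟨u, hu, h, h2⟩
  · right
    refine ⟨by simp [clip, h], fun u hu => absurd hu (h2 u)⟩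
  · rcases le_or_gt u T with hT | hT
    · left
      refine ⟨u, hu, hT, ?_, h2⟩
      have : (u : ℝ≥0∞) ≤ T := by exact_mod_cast hT
      simp [clip, h, min_eq_left this]
    · right
      refine ⟨?_, fun w hw => hT.trans_le (h2 w hw)⟩
      have : (T : ℝ≥0∞) ≤ u := by exact_mod_cast hT.le
      simp [clip, h, min_eq_right this]

lemma clip_bound (κ : ℝ) (a q : ℝ≥0) (haq : a ≤ q) (c : ℝ) (hc : 0 < c) (T : ℝ≥0) (ω : Omega) :
    κ * ω.1 (clip (hit κ a q c) T ω) ≤ κ * ω.1 (clip (hit κ a q 0) T ω) + c := by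
  have hcont := ω.2
  have sub : ∀ u ∈ hitSet κ a q c ω, u ∈ hitSet κ a q 0 ω :=
    fun u hu => ⟨hu.1, fun v hv => by have := hu.2 v hv; linarith⟩
  rcases clip_cases κ a q 0 T ω with ⟨u₀, hu₀, hT, h₀, hmin⟩ | ⟨h₀, hmin⟩
  · rw [h₀]
    have key : ∀ u, q ≤ u → u ∉ hitSet κ a q c ω → κ * ω.1 u ≤ κ * ω.1 u₀ + c := by
      intro u hq hu
      have : ∃ v ∈ Set.Icc a q, κ * ω.1 u < κ * ω.1 v + c := by
        by_contra! hcon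
        exact hu ⟨hq, hcon⟩
      obtain ⟨v, hv, hlt⟩ := this
      have := hu₀.2 v hv
      linarith
    rcases clip_cases κ a q c T ω with ⟨u₁, hu₁, hT1, h₁, hmin1⟩ | ⟨h₁, hmin1⟩
    · rw [h₁]
      have hne : q ≠ u₁ := by
        rintro rfl
        have := hu₁.2 q ⟨haq, le_rfl⟩
        linarith
      have hcl : IsClosed {u : ℝ≥0 | κ * ω.1 u ≤ κ * ω.1 u₀ + c} :=
        isClosed_le (by fun_prop) continuous_const
      have hs : Set.Ico q u₁ ⊆ {u : ℝ≥0 | κ * ω.1 u ≤ κ * ω.1 u₀ + c} := fun u hu =>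
        key u hu.1 fun hm => absurd (hmin1 u hm) (not_le.2 hu.2)
      have := hcl.closure_subset_iff.2 hs
      rw [closure_Ico hne] at this
      exact this ⟨hu₁.1, le_rfl⟩
    · rw [h₁]
      exact key T (hu₀.1.trans hT) fun hm => lt_irrefl _ (hmin1 T hm)
  · rcases clip_cases κ a q c T ω with ⟨u₁, hu₁, hT1, h₁, hmin1⟩ | ⟨h₁, hmin1⟩
    · exact absurd (hmin u₁ (sub u₁ hu₁)) (not_lt.2 hT1)
    · rw [h₀, h₁]; linarith

/-- the basic bad event -/
def Bad (κ : ℝ) (a q s : ℝ≥0) (n : ℕ) : Set Omega :=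
  {ω | a ≤ q ∧ ∃ τ ∈ Set.Icc q s, (∀ v ∈ Set.Icc a s, κ * ω.1 v ≤ κ * ω.1 τ) ∧
    (∃ v ∈ Set.Icc a q, κ * ω.1 v = κ * ω.1 τ) ∧ κ * ω.1 s + 1 / ((n : ℝ) + 1) ≤ κ * ω.1 τ}

lemma bad_strat (κ : ℝ) (a q s : ℝ≥0) (n : ℕ) (e : ℝ) (he : 0 < e) :
    ∃ G : ElemStrategy, (∀ t ω, 0 ≤ elemCapital G e t ω) ∧
      ∀ ω ∈ Bad κ a q s n, ∃ T : ℝ≥0, ∀ t ≥ T, 1 ≤ elemCapital G e t ω := by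
  have hN : (0 : ℝ) < (n : ℝ) + 1 := by positivity
  have hc : 0 < e / ((n : ℝ) + 1) := by positivity
  have general : ∀ a : ℝ≥0, a ≤ q → ∀ t ω,
      0 ≤ elemCapital (strat κ a q s (e / ((n : ℝ) + 1)) hc.le (-κ * ((n : ℝ) + 1))) e t ω := by
    intro a haq t ω
    rw [strat_capital]
    have h := clip_bound κ a q haq _ hc (min s t) ω
    have h2 := mul_le_mul_of_nonneg_left h hN.le
    rw [mul_add, mul_div_cancel₀ _ hN.ne'] at h2
    linarith
  by_cases haq : a ≤ q
  swap
  · exact ⟨_, general q le_rfl, fun ω hω => absurd hω.1 haq⟩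
  refine ⟨_, general a haq, ?_⟩
  rintro ω ⟨-, τ, hτ, hmax, ⟨v, hv, hveq⟩, hs⟩
  refine ⟨s, fun t ht => ?_⟩
  rw [strat_capital, min_eq_left ht]
  have hqs : q ≤ s := hτ.1.trans hτ.2
  have hτA : τ ∈ hitSet κ a q 0 ω :=
    ⟨hτ.1, fun w hw => by have := hmax w ⟨hw.1, hw.2.trans hqs⟩; linarith⟩
  rcases clip_cases κ a q 0 s ω with ⟨u₀, hu₀, hT, h₀, hmin⟩ | ⟨h₀, hmin⟩
  swap
  · exact absurd (hmin τ hτA) (not_lt.2 hτ.2)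
  rcases clip_cases κ a q (e / ((n : ℝ) + 1)) s ω with ⟨u₁, hu₁, hT1, h₁, hmin1⟩ | ⟨h₁, hmin1⟩
  · exfalso
    have h1 := hu₁.2 v hv
    have h2 := hmax u₁ ⟨haq.trans hu₁.1, hT1⟩
    linarith
  rw [h₀, h₁]
  have h1 := hu₀.2 v hv
  have h3 : 1 / ((n : ℝ) + 1) ≤ κ * ω.1 u₀ - κ * ω.1 s := by linarith
  rw [div_le_iff₀ hN] at h3
  linarith

lemma null_of_countable {ι : Type} [Countable ι] [Nonempty ι] (E : ι → Set Omega)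
    (h : ∀ i, ∀ e : ℝ, 0 < e → ∃ G : ElemStrategy, (∀ t ω, 0 ≤ elemCapital G e t ω) ∧
      ∀ ω ∈ E i, ∃ T : ℝ≥0, ∀ t ≥ T, 1 ≤ elemCapital G e t ω)
    (A : Set Omega) (hA : A ⊆ ⋃ i, E i) : IsNull A := by
  obtain ⟨f, hf⟩ := exists_surjective_nat ι
  unfold IsNull
  rw [← nonpos_iff_eq_zero]
  refine ENNReal.le_of_forall_pos_le_add fun d hd _ => ?_
  rw [zero_add]
  have hd' : (0 : ℝ) < d := by exact_mod_cast hd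
  have hcp : ∀ n : ℕ, 0 < (d : ℝ) / 2 / 2 ^ n := fun n => by positivity
  choose G hG1 hG2 using fun n : ℕ => h (f n) _ (hcp n)
  let S : PosCapital := ⟨G, fun n => (d : ℝ) / 2 / 2 ^ n, hcp, summable_geometric_two' _, hG1⟩
  have hS : S.init = d := by
    unfold PosCapital.init
    rw [← ENNReal.ofReal_tsum_of_nonneg (fun n => (hcp n).le) (summable_geometric_two' _)]
    rw [tsum_geometric_two']
    simp
  rw [← hS]
  refine iInf₂_le S ?_
  intro ω
  by_cases hω : ω ∈ A
  swap
  · simp [hω]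
  rw [Set.indicator_of_mem hω]
  obtain ⟨i, hi⟩ := Set.mem_iUnion.1 (hA hω)
  obtain ⟨n, rfl⟩ := hf i
  obtain ⟨T, hT⟩ := hG2 n ω hi
  refine le_liminf_of_le (by isBoundedDefault) ?_
  filter_upwards [eventually_ge_atTop T] with t ht
  calc (1 : ℝ≥0∞) ≤ ENNReal.ofReal (elemCapital (S.G n) (S.c n) t ω) := by
        rw [← ENNReal.ofReal_one]; exact ENNReal.ofReal_le_ofReal (hT t ht)
    _ ≤ _ := ENNReal.le_tsum n

/-- simplified local extremum property -/
def LExt (κ : ℝ) (ω : Omega) (t : ℝ≥0) : Prop :=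
  (∀ r > t, ∃ u ∈ Set.Icc t r, κ * ω.1 u ≠ κ * ω.1 t) ∧
  ∃ δ : ℝ, 0 < δ ∧ ∀ s : ℝ≥0, (t : ℝ) - δ < s → (s : ℝ) < t + δ → κ * ω.1 s ≤ κ * ω.1 t

lemma lext_countable (κ : ℝ) (ω : Omega)
    (hω : ∀ i j k n : ℕ, ω ∉ Bad κ (TopologicalSpace.denseSeq ℝ≥0 i) (TopologicalSpace.denseSeq ℝ≥0 j) (TopologicalSpace.denseSeq ℝ≥0 k) n) :
    {t | LExt κ ω t}.Countable := by
  have hcont := ω.2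
  have hD := TopologicalSpace.denseRange_denseSeq ℝ≥0
  let P : ℕ × ℕ → Set ℝ≥0 := fun p => {t | LExt κ ω t ∧ TopologicalSpace.denseSeq ℝ≥0 p.1 < t ∧
    t < TopologicalSpace.denseSeq ℝ≥0 p.2 ∧
    ∀ v ∈ Set.Icc (TopologicalSpace.denseSeq ℝ≥0 p.1) (TopologicalSpace.denseSeq ℝ≥0 p.2), κ * ω.1 v ≤ κ * ω.1 t}
  have hsub : {t | LExt κ ω t} ⊆ {0} ∪ ⋃ p, P p := by
    intro t ht
    rcases eq_or_ne t 0 with rfl | h0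
    · left; rfl
    right
    obtain ⟨-, δ, hδ, hl⟩ := id ht
    have hpos : 0 < t := pos_iff_ne_zero.2 h0
    have hδ' : 0 < δ.toNNReal := Real.toNNReal_pos.2 hδ
    obtain ⟨_, ⟨i, rfl⟩, hi1, hi2⟩ := hD.exists_between
      (show t - δ.toNNReal < t from tsub_lt_self hpos hδ')
    obtain ⟨_, ⟨j, rfl⟩, hj1, hj2⟩ := hD.exists_between
      (show t < t + δ.toNNReal from lt_add_of_pos_right _ hδ')
    refine Set.mem_iUnion.2 ⟨(i, j), ht, hi2, hj1, fun v hv => hl v ?_ ?_⟩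
    · have h1 : t - δ.toNNReal < v := hi1.trans_le hv.1
      have h1' : t < v + δ.toNNReal := lt_add_of_tsub_lt_right h1
      have h2 : (t : ℝ) < v + (δ.toNNReal : ℝ≥0) := by exact_mod_cast h1'
      rw [Real.coe_toNNReal _ hδ.le] at h2
      linarith
    · have h1 : v < t + δ.toNNReal := hv.2.trans_lt hj2
      have h2 : (v : ℝ) < t + (δ.toNNReal : ℝ≥0) := by exact_mod_cast h1
      rwa [Real.coe_toNNReal _ hδ.le] at h2
  refine Set.Countable.mono hsub ((Set.countable_singleton 0).union
    (Set.countable_iUnion fun p => Set.Subsingleton.countable ?_))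
  have main : ∀ t₁ ∈ P p, ∀ t₂ ∈ P p, ¬ t₁ < t₂ := by
    rintro t₁ ⟨-, h1a, h1b, hm1⟩ t₂ ⟨h2, h2a, h2b, hm2⟩ hlt
    obtain ⟨_, ⟨j, rfl⟩, hj1, hj2⟩ := hD.exists_between hlt
    obtain ⟨r, hr1, hr2⟩ := exists_between h2b
    obtain ⟨u, hu, hune⟩ := h2.1 r hr1
    have hult : κ * ω.1 u < κ * ω.1 t₂ :=
      lt_of_le_of_ne (hm2 u ⟨h2a.le.trans hu.1, hu.2.trans hr2.le⟩) hune
    have hut : t₂ < u := lt_of_le_of_ne hu.1 (by rintro rfl; exact hune rfl)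
    have ho : IsOpen ({x : ℝ≥0 | κ * ω.1 x < κ * ω.1 t₂} ∩ Set.Ioo t₂ (TopologicalSpace.denseSeq ℝ≥0 p.2)) :=
      (isOpen_lt (by fun_prop) continuous_const).inter isOpen_Ioo
    obtain ⟨k, hk1, hk2, hk3⟩ := hD.exists_mem_open ho ⟨u, hult, hut, hu.2.trans_lt hr2⟩
    have hk1' : κ * ω.1 (TopologicalSpace.denseSeq ℝ≥0 k) < κ * ω.1 t₂ := hk1
    have hgap : (0 : ℝ) < κ * ω.1 t₂ - κ * ω.1 (TopologicalSpace.denseSeq ℝ≥0 k) := by linarith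
    obtain ⟨n, hn⟩ := exists_nat_one_div_lt hgap
    refine hω p.1 j k n ⟨(h1a.trans hj1).le, t₂, ⟨hj2.le, hk2.le⟩,
      fun v hv => hm2 v ⟨hv.1, hv.2.trans hk3.le⟩, ⟨t₁, ⟨h1a.le, hj1.le⟩, ?_⟩, by linarith⟩
    exact le_antisymm (hm2 t₁ ⟨h1a.le, h1b.le⟩) (hm1 t₂ ⟨h2a.le, h2b.le⟩)
  intro t₁ h1 t₂ h2
  exact le_antisymm (not_lt.1 (main t₂ h2 t₁ h1)) (not_lt.1 (main t₁ h1 t₂ h2))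

lemma lext_of (κ : ℝ) (hκ : κ ≠ 0) (r : ℝ → ℝ → Prop) (hr : ∀ x y, r x y → κ * x ≤ κ * y)
    (ω : Omega) (t : ℝ≥0) (h : IntervalOfLocalExt r ω t t) : LExt κ ω t := by
  obtain ⟨-, -, hnc, δ, hδ, hl⟩ := h
  refine ⟨fun x hx => ?_, δ, hδ, fun s h1 h2 => ?_⟩
  · by_contra! hcon
    exact hnc ⟨t, x, le_rfl, hx.le, Or.inr hx, fun u hu => mul_left_cancel₀ hκ (hcon u hu)⟩
  · rcases lt_trichotomy s t with h | rfl | h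
    · exact hr _ _ (hl s (Or.inl ⟨h1, h⟩))
    · exact le_rfl
    · exact hr _ _ (hl s (Or.inr ⟨h, h2⟩))

/-- almost surely, the set of points of local extremum of `ω` is
countable: the set of `ω` for which it is uncountable is null. -/
theorem points_of_local_extremum_countable :
    IsNull {ω : Omega | ¬ Set.Countable {t : ℝ≥0 |
      IntervalOfLocalExt (· ≤ ·) ω t t ∨ IntervalOfLocalExt (· ≥ ·) ω t t}} := by
  let d := TopologicalSpace.denseSeq ℝ≥0
  refine null_of_countable (ι := Bool × ℕ × ℕ × ℕ × ℕ)
    (fun p => Bad (if p.1 then 1 else -1) (d p.2.1) (d p.2.2.1) (d p.2.2.2.1) p.2.2.2.2)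
    (fun p e he => bad_strat _ _ _ _ _ e he) _ ?_
  intro ω hω
  by_contra hcon
  rw [Set.mem_iUnion, not_exists] at hcon
  apply hω
  refine Set.Countable.mono ?_ ((lext_countable 1 ω fun i j k n hb => ?_).union
    (lext_countable (-1) ω fun i j k n hb => ?_))
  · rintro t (ht | ht)
    · exact Or.inl (lext_of 1 one_ne_zero _ (fun x y h => by simpa using h) ω t ht)
    · exact Or.inr (lext_of (-1) (by norm_num) _ (fun x y h => by simpa using h) ω t ht)
  · exact hcon (true, i, j, k, n) (by simpa [d] using hb)
  · exact hcon (false, i, j, k, n) (by simpa [d] using hb)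

end GTP
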